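/- Let n, s ≥ 1 and N = n + s. Suppose M ∈ Sym₀(ℝ^n) has a feasible decomposition λ with exactly d nonzero values and Σ_m λ(m) = T. Let M̂ ∈ Sym₀(ℝ^N) be the matrix with M in the upper-left n×n block and all other entries zero. Then M̂ has a feasible decomposition γ (over encodings in {−1,+1}^N) with at most d·2^⌈log₂(s+1)⌉ nonzero values and Σ_w γ(w) = T. -/

import Mathlib

/-- The sign `m = (−1)^b` of a bit: encodings `m ∈ {−1,+1}^n` are represented by
boolean vectors `b : Fin n → Bool` via `m i = sgn (b i)`. -/
def sgn (b : Bool) : ℝ := if b then -1 else 1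

/-- `lam` is a feasible decomposition of `M ∈ Sym₀(ℝ^n)`:
`lam ≥ 0` and `M i j = Σ_{m ∈ {−1,+1}^n} lam m * m_i * m_j` for all `i ≠ j`. -/
def IsDecomp {n : ℕ} (M : Matrix (Fin n) (Fin n) ℝ)
    (lam : (Fin n → Bool) → ℝ) : Prop :=
  (∀ m, 0 ≤ lam m) ∧
  ∀ i j : Fin n, i ≠ j →
    M i j = ∑ m : Fin n → Bool, lam m * sgn (m i) * sgn (m j)

/-- The optimal gate time `T(M)`: infimum of `Σ_m lam m` over feasible decompositions. -/
noncomputable def gateTime {n : ℕ} (M : Matrix (Fin n) (Fin n) ℝ) : ℝ :=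
  sInf { t | ∃ lam, IsDecomp M lam ∧ ∑ m : Fin n → Bool, lam m = t }

theorem sgn_mul_self (b : Bool) : sgn b * sgn b = 1 := by
  cases b <;> norm_num [sgn]

theorem sgn_xor (a b : Bool) : sgn (xor a b) = sgn a * sgn b := by
  cases a <;> cases b <;> norm_num [sgn]

theorem exists_sgn_eq_prod {ι : Type*} (S : Finset ι) (x : ι → Bool) :
    ∃ b : Bool, sgn b = ∏ i ∈ S, sgn (x i) := by
  classical
  induction S using Finset.induction_on with
  | empty => exact ⟨false, by simp [sgn]⟩
  | insert a S ha ih =>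
    obtain ⟨b, hb⟩ := ih
    exact ⟨xor (x a) b, by rw [sgn_xor, hb, Finset.prod_insert ha]⟩

/-- Orthogonality of distinct Walsh functions on the Boolean cube. -/
theorem sum_prod_sgn_mul_prod_sgn {ι : Type*} [Fintype ι] [DecidableEq ι]
    {S T : Finset ι} (hST : S ≠ T) :
    ∑ x : ι → Bool, (∏ i ∈ S, sgn (x i)) * ∏ i ∈ T, sgn (x i) = 0 := by
  obtain ⟨i, hi⟩ : ∃ i, ¬(i ∈ S ↔ i ∈ T) := by
    by_contra! h
    exact hST (Finset.ext h)
  let f : ι → Bool → ℝ := fun j b => (if j ∈ S then sgn b else 1) * if j ∈ T then sgn b else 1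
  have hf : ∀ x : ι → Bool,
      (∏ i ∈ S, sgn (x i)) * ∏ i ∈ T, sgn (x i) = ∏ j, f j (x j) := by
    intro x
    simp only [f, Finset.prod_mul_distrib, Finset.prod_ite_mem, Finset.univ_inter]
  simp_rw [hf]
  rw [← Fintype.prod_sum]
  refine Finset.prod_eq_zero (Finset.mem_univ i) ?_
  by_cases h1 : i ∈ S <;> by_cases h2 : i ∈ T <;> simp_all [f, sgn]

/-- Sign vectors indexed by the Boolean cube of dimension `k` include `r` pairwise orthogonal
ones as soon as `r ≤ 2 ^ k`. -/
theorem exists_orthogonal_signs {r k : ℕ} (hr : r ≤ 2 ^ k) :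
    ∃ h : Fin r → (Fin k → Bool) → Bool, ∀ a b, a ≠ b →
      ∑ x, sgn (h a x) * sgn (h b x) = 0 := by
  obtain ⟨e⟩ : Nonempty (Fin r ↪ Finset (Fin k)) :=
    Function.Embedding.nonempty_of_card_le (by simpa using hr)
  choose g hg using fun (S : Finset (Fin k)) x => exists_sgn_eq_prod S x
  refine ⟨fun a => g (e a), fun a b hab => ?_⟩
  simp_rw [hg]
  exact sum_prod_sgn_mul_prod_sgn (e.injective.ne hab)

/-- The pushforward of a finitely supported weight along a map. -/
theorem exists_pushforward {α β : Type*} [Fintype α] [Fintype β] (p : α → ℝ) (hp : ∀ a, 0 ≤ p a)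
    (f : α → β) :
    ∃ q : β → ℝ, (∀ b, 0 ≤ q b) ∧ {b | q b ≠ 0}.ncard ≤ {a | p a ≠ 0}.ncard ∧
      ∀ g : β → ℝ, ∑ b, q b * g b = ∑ a, p a * g (f a) := by
  classical
  refine ⟨fun b => ∑ a, if f a = b then p a else 0, fun b => ?_, ?_, fun g => ?_⟩
  · exact Finset.sum_nonneg fun a _ => by split_ifs <;> simp [hp]
  · refine (Set.ncard_le_ncard ?_ (Set.toFinite (f '' {a | p a ≠ 0}))).trans
      (Set.ncard_image_le (Set.toFinite _))
    intro b hb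
    obtain ⟨a, -, ha⟩ := Finset.exists_ne_zero_of_sum_ne_zero hb
    obtain ⟨h1, h2⟩ := ite_ne_right_iff.mp ha
    exact ⟨a, h2, h1⟩
  · simp_rw [Finset.sum_mul]
    rw [Finset.sum_comm]
    simp [ite_mul]

/-- excluding qubits: if `M ∈ Sym₀(ℝ^n)` has a feasible decomposition `λ`
with exactly `d` nonzero values and total `T`, and `M̂ ∈ Sym₀(ℝ^{n+s})` is `M` padded with
zeros, then `M̂` has a feasible decomposition `γ` with at most `d·2^⌈log₂(s+1)⌉` nonzero
values and total `T`. -/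
theorem stmt_6 {n s : ℕ} (hn : 1 ≤ n) (hs : 1 ≤ s)
    (M : Matrix (Fin n) (Fin n) ℝ)
    (lam : (Fin n → Bool) → ℝ) (hlam : IsDecomp M lam)
    (d : ℕ) (hd : {m | lam m ≠ 0}.ncard = d)
    (T : ℝ) (hT : ∑ m : Fin n → Bool, lam m = T)
    (Mhat : Matrix (Fin (n + s)) (Fin (n + s)) ℝ)
    (hMhat : ∀ a b : Fin (n + s), Mhat a b =
      if h : (a : ℕ) < n ∧ (b : ℕ) < n then M ⟨a, h.1⟩ ⟨b, h.2⟩ else 0) :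
    ∃ γ : (Fin (n + s) → Bool) → ℝ, IsDecomp Mhat γ ∧
      {w | γ w ≠ 0}.ncard ≤ d * 2 ^ (Nat.clog 2 (s + 1)) ∧
      ∑ w : Fin (n + s) → Bool, γ w = T := by
  have hk := Nat.le_pow_clog one_lt_two (s + 1)
  generalize Nat.clog 2 (s + 1) = k at hk ⊢
  obtain ⟨h, hh⟩ := exists_orthogonal_signs hk
  let idx : Fin (n + s) → Fin (s + 1) := fun a => ⟨a + 1 - n, by omega⟩
  let base : (Fin n → Bool) → Fin (n + s) → Bool := fun m a =>
    if ha : (a : ℕ) < n then m ⟨a, ha⟩ else false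
  let enc : (Fin n → Bool) × (Fin k → Bool) → Fin (n + s) → Bool := fun z a =>
    xor (base z.1 a) (h (idx a) z.2)
  have hpow : (2 : ℝ) ^ k ≠ 0 := by positivity
  obtain ⟨γ, hγ0, hγc, hγ⟩ := exists_pushforward
    (fun z : (Fin n → Bool) × (Fin k → Bool) => lam z.1 / 2 ^ k)
    (fun z => div_nonneg (hlam.1 _) (by positivity)) enc
  refine ⟨γ, ⟨hγ0, fun a b hab => ?_⟩, hγc.trans ?_, ?_⟩
  · simp_rw [mul_assoc]
    rw [hγ fun w => sgn (w a) * sgn (w b), Fintype.sum_prod_type]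
    have key : ∀ m : Fin n → Bool,
        ∑ x, lam m / 2 ^ k * (sgn (enc (m, x) a) * sgn (enc (m, x) b)) =
          lam m / 2 ^ k * (sgn (base m a) * sgn (base m b)) *
            ∑ x, sgn (h (idx a) x) * sgn (h (idx b) x) := by
      intro m
      rw [Finset.mul_sum]
      refine Finset.sum_congr rfl fun x _ => ?_
      simp only [enc, sgn_xor]
      ring
    simp_rw [key]
    rw [hMhat]
    have hab' : (a : ℕ) ≠ b := fun h => hab (Fin.ext h)
    split_ifs with hn'
    · have hidx : idx a = idx b := Fin.ext (by simp only [idx]; omega)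
      rw [hlam.2 _ _ (by simpa using hab')]
      refine Finset.sum_congr rfl fun m _ => ?_
      simp only [hidx, sgn_mul_self, base, hn'.1, hn'.2, dif_pos]
      simp
      field_simp
    · have hidx : idx a ≠ idx b := fun he => by
        have := congrArg Fin.val he
        simp only [idx] at this
        omega
      simp [hh _ _ hidx]
  · have hset : {z : (Fin n → Bool) × (Fin k → Bool) | lam z.1 / 2 ^ k ≠ 0} =
        {m | lam m ≠ 0} ×ˢ Set.univ := by
      ext z
      simp
    rw [hset, Set.ncard_prod, hd]
    simp [Set.ncard_univ]
  · have := hγ fun _ => 1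
    simp only [mul_one] at this
    rw [this, Fintype.sum_prod_type, ← hT]
    refine Finset.sum_congr rfl fun m _ => ?_
    simp
    field_simp
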